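/- arXiv:1308.1355 — 5 statements merged into one kernel-verified Lean document; each statement's English description precedes it below -/
import Mathlib

section
/- Let F : ℝ × ℝ → ℝ be nondecreasing in its first argument and nonincreasing in its second argument with F(s,s) = f(s) for all s, and let λ > 0 satisfy the CFL condition λ·[|F(u,q) − F(v,q)| + |F(p,u) − F(p,v)|] ≤ |u − v| for all u, v, p, q ∈ ℝ. Let (ū_j)_{j∈ℤ} be a bounded sequence and define u_j' := ū_j − λ·[F(ū_j, ū_{j+1}) − F(ū_{j−1}, ū_j)] for each j. Then sup_j |u_j'| ≤ sup_j |ū_j|. -/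
/-- `L^∞` stability of the explicit monotone finite-volume step: under the CFL condition,
`sup_j |u'_j| ≤ sup_j |ū_j|` where `u'_j = ū_j - λ (F(ū_j,ū_{j+1}) - F(ū_{j-1},ū_j))`. -/
theorem explicit_step_sup_bound (f : ℝ → ℝ) (F : ℝ → ℝ → ℝ)
    (hF₁ : ∀ b : ℝ, Monotone fun a => F a b)
    (hF₂ : ∀ a : ℝ, Antitone fun b => F a b)
    (hcons : ∀ s : ℝ, F s s = f s)
    (lam : ℝ) (hlam : 0 < lam)
    (hCFL : ∀ u v p q : ℝ, lam * (|F u q - F v q| + |F p u - F p v|) ≤ |u - v|)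
    (ub : ℤ → ℝ) (hbdd : BddAbove (Set.range fun j => |ub j|))
    (u' : ℤ → ℝ)
    (hu' : ∀ j : ℤ, u' j = ub j - lam * (F (ub j) (ub (j + 1)) - F (ub (j - 1)) (ub j))) :
    ⨆ j : ℤ, |u' j| ≤ ⨆ j : ℤ, |ub j| := by
  apply ciSup_le
  intro j
  set M := ⨆ j : ℤ, |ub j| with hM
  have hb : ∀ i, |ub i| ≤ M := fun i => le_ciSup hbdd i
  have key : ∀ i, -M ≤ ub i ∧ ub i ≤ M := fun i => abs_le.mp (hb i)
  obtain ⟨ha1, ha2⟩ := key (j - 1)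
  obtain ⟨hb1, hb2⟩ := key j
  obtain ⟨hc1, hc2⟩ := key (j + 1)
  rw [hu' j]
  generalize ub (j - 1) = a at *
  generalize ub (j + 1) = c at *
  generalize ub j = b at *
  have c1 := hCFL M b M M
  have c2 := hCFL b (-M) (-M) (-M)
  rw [abs_of_nonneg (sub_nonneg.2 hb2)] at c1
  rw [abs_of_nonneg (sub_nonneg.2 hb1)] at c2
  have h1 : F b M ≤ F b c := hF₂ b hc2
  have h2 : F a b ≤ F M b := hF₁ b ha2
  have h3 : F b c ≤ F b (-M) := hF₂ b hc1
  have h4 : F (-M) b ≤ F a b := hF₁ b ha1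
  have d1 : F a b - F b c ≤ |F M M - F b M| + |F M M - F M b| := by
    have := le_abs_self (F M M - F b M)
    have := neg_abs_le (F M M - F M b)
    linarith
  have d2 : F b c - F a b ≤ |F b (-M) - F (-M) (-M)| + |F (-M) b - F (-M) (-M)| := by
    have := le_abs_self (F b (-M) - F (-M) (-M))
    have := neg_abs_le (F (-M) b - F (-M) (-M))
    linarith
  have e1 := mul_le_mul_of_nonneg_left d1 hlam.le
  have e2 := mul_le_mul_of_nonneg_left d2 hlam.le
  rw [abs_le]
  constructor <;> linarith
end

section
/- Let F : ℝ × ℝ → ℝ be nondecreasing in its first argument and nonincreasing in its second argument, consistent with f (F(s,s) = f(s)), and let λ > 0 satisfy the CFL condition λ·[|F(u,q) − F(v,q)| + |F(p,u) − F(p,v)|] ≤ |u − v| for all u, v, p, q ∈ ℝ. Let (ū_j)_{j∈ℤ} be a sequence of bounded total variation and define u_j' := ū_j − λ·[F(ū_j, ū_{j+1}) − F(ū_{j−1}, ū_j)]. Then Σ_{j∈ℤ} |u_{j+1}' − u_j'| ≤ Σ_{j∈ℤ} |ū_{j+1} − ū_j|, i.e., the explicit step is total variation diminishing. -/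
/-- The explicit monotone finite-volume step is total variation diminishing (TVD)
under the CFL condition:
`Σ_j |u'_{j+1} - u'_j| ≤ Σ_j |ū_{j+1} - ū_j|`
where `u'_j = ū_j - λ (F(ū_j,ū_{j+1}) - F(ū_{j-1},ū_j))`. -/
theorem explicit_step_TVD (f : ℝ → ℝ) (F : ℝ → ℝ → ℝ)
    (hF₁ : ∀ b : ℝ, Monotone fun a => F a b)
    (hF₂ : ∀ a : ℝ, Antitone fun b => F a b)
    (hcons : ∀ s : ℝ, F s s = f s)
    (lam : ℝ) (hlam : 0 < lam)
    (hCFL : ∀ u v p q : ℝ, lam * (|F u q - F v q| + |F p u - F p v|) ≤ |u - v|)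
    (ub : ℤ → ℝ) (hTV : Summable fun j : ℤ => |ub (j + 1) - ub j|)
    (u' : ℤ → ℝ)
    (hu' : ∀ j : ℤ, u' j = ub j - lam * (F (ub j) (ub (j + 1)) - F (ub (j - 1)) (ub j))) :
    ∑' j : ℤ, |u' (j + 1) - u' j| ≤ ∑' j : ℤ, |ub (j + 1) - ub j| := by
  obtain ⟨C, hC⟩ : ∃ C : ℤ → ℝ, ∀ j, C j =
    lam * (F (ub (j + 1)) (ub (j + 1)) - F (ub j) (ub (j + 1))) := ⟨_, fun _ => rfl⟩
  obtain ⟨D, hD⟩ : ∃ D : ℤ → ℝ, ∀ j, D j =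
    lam * (F (ub j) (ub j) - F (ub j) (ub (j + 1))) := ⟨_, fun _ => rfl⟩
  have hsum : ∀ j, |C j| + |D j| ≤ |ub (j + 1) - ub j| := by
    intro j
    have h := hCFL (ub (j + 1)) (ub j) (ub j) (ub (j + 1))
    rw [hC, hD, abs_mul, abs_mul, abs_of_pos hlam,
      abs_sub_comm (F (ub j) (ub j)) (F (ub j) (ub (j + 1)))]
    linarith
  have habs : ∀ j, |ub (j + 1) - ub j - C j - D j| = |ub (j + 1) - ub j| - |C j| - |D j| := by
    intro j
    have h := hsum j
    rcases le_total (ub j) (ub (j + 1)) with hle | hle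
    · have h1 : 0 ≤ C j := by
        rw [hC]; exact mul_nonneg hlam.le (sub_nonneg.2 (hF₁ _ hle))
      have h2 : 0 ≤ D j := by
        rw [hD]; exact mul_nonneg hlam.le (sub_nonneg.2 (hF₂ _ hle))
      rw [abs_of_nonneg h1, abs_of_nonneg h2, abs_of_nonneg (sub_nonneg.2 hle)] at *
      rw [abs_of_nonneg (by linarith)]
    · have h1 : C j ≤ 0 := by
        rw [hC]; exact mul_nonpos_of_nonneg_of_nonpos hlam.le (sub_nonpos.2 (hF₁ _ hle))
      have h2 : D j ≤ 0 := by
        rw [hD]; exact mul_nonpos_of_nonneg_of_nonpos hlam.le (sub_nonpos.2 (hF₂ _ hle))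
      rw [abs_of_nonpos h1, abs_of_nonpos h2, abs_of_nonpos (sub_nonpos.2 hle)] at *
      rw [abs_of_nonpos (by linarith)]
      ring
  have hCs : Summable fun j => |C j| :=
    Summable.of_nonneg_of_le (fun _ => abs_nonneg _)
      (fun j => by linarith [hsum j, abs_nonneg (D j)]) hTV
  have hDs : Summable fun j => |D j| :=
    Summable.of_nonneg_of_le (fun _ => abs_nonneg _)
      (fun j => by linarith [hsum j, abs_nonneg (C j)]) hTV
  have hC1 : HasSum (fun j => |C (j - 1)|) (∑' j, |C j|) :=
    (Equiv.subRight (1 : ℤ)).hasSum_iff (f := fun j => |C j|) |>.2 hCs.hasSum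
  have hD1 : HasSum (fun j => |D (j + 1)|) (∑' j, |D j|) :=
    (Equiv.addRight (1 : ℤ)).hasSum_iff (f := fun j => |D j|) |>.2 hDs.hasSum
  have hT := (((hTV.hasSum.sub hCs.hasSum).sub hDs.hasSum).add hD1).add hC1
  have hle : ∀ j, |u' (j + 1) - u' j| ≤
      |ub (j + 1) - ub j| - |C j| - |D j| + |D (j + 1)| + |C (j - 1)| := by
    intro j
    have e : u' (j + 1) - u' j =
        (ub (j + 1) - ub j - C j - D j) + D (j + 1) + C (j - 1) := by
      rw [hu', hu', hC, hC, hD, hD, add_sub_cancel_right, sub_add_cancel]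
      ring
    rw [e, ← habs j]
    exact abs_add_three _ _ _
  have hs : Summable fun j => |u' (j + 1) - u' j| :=
    Summable.of_nonneg_of_le (fun _ => abs_nonneg _) hle hT.summable
  have := hasSum_le hle hs.hasSum hT
  linarith
end

section
/- Let F : ℝ × ℝ → ℝ be nondecreasing in its first argument, nonincreasing in its second argument, consistent (F(s,s) = f(s)), and let λ > 0 satisfy the CFL condition λ·[|F(u,q) − F(v,q)| + |F(p,u) − F(p,v)|] ≤ |u − v| for all u, v, p, q ∈ ℝ. Define H(a,b,c) := b − λ·[F(b,c) − F(a,b)]. Then for every k ∈ ℝ and all a, b, c ∈ ℝ: max(H(a,b,c), k) ≤ H(max(a,k), max(b,k), max(c,k)) and min(H(a,b,c), k) ≥ H(min(a,k), min(b,k), min(c,k)). -/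
/-- For the monotone finite-volume update `H(a,b,c) = b - λ (F(b,c) - F(a,b))` of a
consistent monotone numerical flux `F` under the CFL condition, and any `k`:
`H(a,b,c) ∨ k ≤ H(a ∨ k, b ∨ k, c ∨ k)` and `H(a,b,c) ∧ k ≥ H(a ∧ k, b ∧ k, c ∧ k)`. -/
theorem scheme_max_min_bounds (f : ℝ → ℝ) (F : ℝ → ℝ → ℝ)
    (hF₁ : ∀ b : ℝ, Monotone fun a => F a b)
    (hF₂ : ∀ a : ℝ, Antitone fun b => F a b)
    (hcons : ∀ s : ℝ, F s s = f s)
    (lam : ℝ) (hlam : 0 < lam)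
    (hCFL : ∀ u v p q : ℝ, lam * (|F u q - F v q| + |F p u - F p v|) ≤ |u - v|) :
    ∀ k a b c : ℝ,
      max (b - lam * (F b c - F a b)) k ≤
        max b k - lam * (F (max b k) (max c k) - F (max a k) (max b k)) ∧
      min b k - lam * (F (min b k) (min c k) - F (min a k) (min b k)) ≤
        min (b - lam * (F b c - F a b)) k := by
  have mono : ∀ a b c a' b' c' : ℝ, a ≤ a' → b ≤ b' → c ≤ c' →
      b - lam * (F b c - F a b) ≤ b' - lam * (F b' c' - F a' b') := by
    intro a b c a' b' c' ha hb hc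
    have h1 : F b' c' ≤ F b' c := hF₂ b' hc
    have h2 : F a b' ≤ F a' b' := hF₁ b' ha
    have h3 := hCFL b' b a c
    rw [abs_of_nonneg (sub_nonneg.2 hb)] at h3
    have h4 := le_abs_self (F b' c - F b c)
    have h5 := neg_abs_le (F a b' - F a b)
    have h6 : lam * ((F b' c' - F a' b') - (F b c - F a b)) ≤
        lam * (|F b' c - F b c| + |F a b' - F a b|) :=
      mul_le_mul_of_nonneg_left (by linarith) hlam.le
    linarith
  intro k a b c
  have hk : k - lam * (F k k - F k k) = k := by ring
  refine ⟨max_le ?_ ?_, le_min ?_ ?_⟩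
  · exact mono _ _ _ _ _ _ (le_max_left _ _) (le_max_left _ _) (le_max_left _ _)
  · have h := mono k k k _ _ _ (le_max_right a k) (le_max_right b k) (le_max_right c k)
    rwa [hk] at h
  · exact mono _ _ _ _ _ _ (min_le_left _ _) (min_le_left _ _) (min_le_left _ _)
  · have h := mono _ _ _ k k k (min_le_right a k) (min_le_right b k) (min_le_right c k)
    rwa [hk] at h
end

section
/- Let F : ℝ × ℝ → ℝ be nondecreasing in its first argument, nonincreasing in its second argument, consistent (F(s,s) = f(s)), and let λ > 0 satisfy the CFL condition λ·[|F(u,q) − F(v,q)| + |F(p,u) − F(p,v)|] ≤ |u − v| for all u, v, p, q ∈ ℝ. Define H(a,b,c) := b − λ·[F(b,c) − F(a,b)] and, for k ∈ ℝ, the numerical entropy flux G_k(a,b) := F(max(a,k), max(b,k)) − F(min(a,k), min(b,k)). Then for all a, b, c, k ∈ ℝ: |H(a,b,c) − k| ≤ |b − k| − λ·[G_k(b,c) − G_k(a,b)]. -/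
/-- Crandall–Majda discrete entropy inequality for the explicit monotone step:
with `H(a,b,c) = b - λ (F(b,c) - F(a,b))` and the numerical entropy flux
`G_k(a,b) = F(a ∨ k, b ∨ k) - F(a ∧ k, b ∧ k)`, under the CFL condition one has
`|H(a,b,c) - k| ≤ |b - k| - λ (G_k(b,c) - G_k(a,b))`. -/
theorem discrete_entropy_flux_inequality (f : ℝ → ℝ) (F : ℝ → ℝ → ℝ)
    (hF₁ : ∀ b : ℝ, Monotone fun a => F a b)
    (hF₂ : ∀ a : ℝ, Antitone fun b => F a b)
    (hcons : ∀ s : ℝ, F s s = f s)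
    (lam : ℝ) (hlam : 0 < lam)
    (hCFL : ∀ u v p q : ℝ, lam * (|F u q - F v q| + |F p u - F p v|) ≤ |u - v|) :
    ∀ a b c k : ℝ,
      |(b - lam * (F b c - F a b)) - k| ≤
        |b - k| - lam *
          ((F (max b k) (max c k) - F (min b k) (min c k))
            - (F (max a k) (max b k) - F (min a k) (min b k))) := by
  have hmono : ∀ a b c a' b' c' : ℝ, a ≤ a' → b ≤ b' → c ≤ c' →
      b - lam * (F b c - F a b) ≤ b' - lam * (F b' c' - F a' b') := by
    intro a b c a' b' c' ha hb hc
    have h1 : F a b ≤ F a' b := hF₁ b ha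
    have h2 : F b c' ≤ F b c := hF₂ b hc
    have h3 := hCFL b' b a' c'
    rw [abs_of_nonneg (sub_nonneg.2 hb)] at h3
    have h4 := le_abs_self (F b' c' - F b c')
    have h5 := neg_abs_le (F a' b' - F a' b)
    have h6 : lam * ((F b' c' - F a' b') - (F b c - F a b)) ≤
        lam * (|F b' c' - F b c'| + |F a' b' - F a' b|) :=
      mul_le_mul_of_nonneg_left (by linarith) hlam.le
    linarith
  intro a b c k
  have h1 := hmono a b c _ _ _ (le_max_left a k) (le_max_left b k) (le_max_left c k)
  have h2 := hmono k k k _ _ _ (le_max_right a k) (le_max_right b k) (le_max_right c k)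
  have h3 := hmono _ _ _ a b c (min_le_left a k) (min_le_left b k) (min_le_left c k)
  have h4 := hmono _ _ _ k k k (min_le_right a k) (min_le_right b k) (min_le_right c k)
  have h5 : |b - k| = max b k - min b k := (max_sub_min_eq_abs' b k).symm
  rw [h5, abs_le]
  constructor <;> linarith
end

section
/- Consider the splitting scheme ū_j^n = u_j^n + Δt·g(x_j, t^n, ū_j^n), u_j^{n+1} = ū_j^n − (Δt/Δx)[F(ū_j^n, ū_{j+1}^n) − F(ū_{j−1}^n, ū_j^n)], where F : ℝ × ℝ → ℝ is locally Lipschitz, consistent (F(s,s) = f(s)), nondecreasing in its first argument and nonincreasing in its second, g is Lipschitz in u uniformly in (x,t) and bounded for each fixed u, and the CFL condition (Δt/Δx)[|F(u,q) − F(v,q)| + |F(p,u) − F(p,v)|] ≤ |u − v| holds for all u,v,p,q. Then for all j ∈ ℤ, n ∈ ℕ, and k ∈ ℝ: |u_j^{n+1} − k| − |u_j^n − k| + (Δt/Δx)·[F(ū_j^n ∨ k, ū_{j+1}^n ∨ k) − F(ū_j^n ∧ k, ū_{j+1}^n ∧ k) − F(ū_{j−1}^n ∨ k, ū_j^n ∨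 k) + F(ū_{j−1}^n ∧ k, ū_j^n ∧ k)] ≤ sign(ū_j^n − k)·Δt·g(x_j, t^n, ū_j^n). -/
/-- Monotonicity of the three-point update under the CFL condition. -/
theorem splitting_update_mono (F : ℝ → ℝ → ℝ) (l : ℝ) (hl : 0 ≤ l)
    (h1 : ∀ b : ℝ, Monotone fun a => F a b)
    (h2 : ∀ a : ℝ, Antitone fun b => F a b)
    (hCFL : ∀ u v p q : ℝ, l * (|F u q - F v q| + |F p u - F p v|) ≤ |u - v|)
    {a b c a' b' c' : ℝ} (ha : a ≤ a') (hb : b ≤ b') (hc : c ≤ c') :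
    b - l * (F b c - F a b) ≤ b' - l * (F b' c' - F a' b') := by
  have e1 : F a b' ≤ F a' b' := h1 b' ha
  have e2 : F b' c' ≤ F b' c := h2 b' hc
  have e3 := hCFL b' b a c
  rw [abs_of_nonneg (sub_nonneg.2 hb)] at e3
  have e4 : (F b' c - F b c) + (F a b - F a b') ≤ |F b' c - F b c| + |F a b' - F a b| := by
    have := le_abs_self (F b' c - F b c)
    have := neg_le_abs (F a b' - F a b)
    linarith
  have e5 := mul_le_mul_of_nonneg_left e4 hl
  have e6 := mul_le_mul_of_nonneg_left e1 hl
  have e7 := mul_le_mul_of_nonneg_left e2 hl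
  linarith

/-- Discrete entropy inequality for the splitting scheme
`ū_j^n = u_j^n + Δt g(x_j, t^n, ū_j^n)`,
`u_j^{n+1} = ū_j^n - (Δt/Δx)(F(ū_j^n, ū_{j+1}^n) - F(ū_{j-1}^n, ū_j^n))`:
for every `j ∈ ℤ`, `n ∈ ℕ`, `k ∈ ℝ`,
`|u_j^{n+1} - k| - |u_j^n - k| + (Δt/Δx)[F(ū_j^n ∨ k, ū_{j+1}^n ∨ k) -
 F(ū_j^n ∧ k, ū_{j+1}^n ∧ k) - F(ū_{j-1}^n ∨ k, ū_j^n ∨ k) + F(ū_{j-1}^n ∧ k, ū_j^n ∧ k)]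
 ≤ sign(ū_j^n - k) Δt g(x_j, t^n, ū_j^n)`. -/
theorem splitting_scheme_discrete_entropy
    (f : ℝ → ℝ) (g : ℝ → ℝ → ℝ → ℝ) (F : ℝ → ℝ → ℝ)
    (L Δt Δx : ℝ) (hΔt : 0 < Δt) (hΔx : 0 < Δx)
    (hg_lip : ∀ x t a b : ℝ, |g x t a - g x t b| ≤ L * |a - b|)
    (hg_bdd : ∀ w : ℝ, ∃ M : ℝ, ∀ x t : ℝ, |g x t w| ≤ M)
    (hF_llip : LocallyLipschitz fun p : ℝ × ℝ => F p.1 p.2)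
    (hF_cons : ∀ s : ℝ, F s s = f s)
    (hF_mono1 : ∀ b : ℝ, Monotone fun a => F a b)
    (hF_mono2 : ∀ a : ℝ, Antitone fun b => F a b)
    (hCFL : ∀ u v p q : ℝ,
      (Δt / Δx) * (|F u q - F v q| + |F p u - F p v|) ≤ |u - v|)
    (u ub : ℕ → ℤ → ℝ)
    (hsrc : ∀ (n : ℕ) (j : ℤ),
      ub n j = u n j + Δt * g ((j : ℝ) * Δx) ((n : ℝ) * Δt) (ub n j))
    (hfv : ∀ (n : ℕ) (j : ℤ),
      u (n + 1) j = ub n j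
        - (Δt / Δx) * (F (ub n j) (ub n (j + 1)) - F (ub n (j - 1)) (ub n j))) :
    ∀ (j : ℤ) (n : ℕ) (k : ℝ),
      |u (n + 1) j - k| - |u n j - k|
        + (Δt / Δx) *
          (F (max (ub n j) k) (max (ub n (j + 1)) k)
            - F (min (ub n j) k) (min (ub n (j + 1)) k)
            - F (max (ub n (j - 1)) k) (max (ub n j) k)
            + F (min (ub n (j - 1)) k) (min (ub n j) k))
      ≤ Real.sign (ub n j - k) * (Δt * g ((j : ℝ) * Δx) ((n : ℝ) * Δt) (ub n j)) := by
  intro j n k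
  have hl : 0 ≤ Δt / Δx := by positivity
  have hs := hsrc n j
  have hf := hfv n j
  generalize Δt * g ((j : ℝ) * Δx) ((n : ℝ) * Δt) (ub n j) = G at hs ⊢
  generalize Δt / Δx = l at *
  generalize ub n (j - 1) = a at *
  generalize ub n (j + 1) = c at *
  generalize ub n j = b at *
  generalize u (n + 1) j = w at *
  generalize u n j = v at *
  have m1 := splitting_update_mono F l hl hF_mono1 hF_mono2 hCFL
    (le_max_left a k) (le_max_left b k) (le_max_left c k)
  have m2 := splitting_update_mono F l hl hF_mono1 hF_mono2 hCFL
    (le_max_right a k) (le_max_right b k) (le_max_right c k)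
  have m3 := splitting_update_mono F l hl hF_mono1 hF_mono2 hCFL
    (min_le_left a k) (min_le_left b k) (min_le_left c k)
  have m4 := splitting_update_mono F l hl hF_mono1 hF_mono2 hCFL
    (min_le_right a k) (min_le_right b k) (min_le_right c k)
  have hmm : max b k - min b k = |b - k| := max_sub_min_eq_abs' b k
  have key : |w - k| ≤ |b - k| - l * (F (max b k) (max c k) - F (min b k) (min c k)
      - F (max a k) (max b k) + F (min a k) (min b k)) := by
    rw [← hmm, abs_le]
    constructor <;> linarith
  have src : |b - k| - |v - k| ≤ Real.sign (b - k) * G := by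
    have p1 := le_abs_self (v - k)
    have p2 := neg_le_abs (v - k)
    rcases lt_trichotomy (b - k) 0 with h | h | h
    · rw [Real.sign_of_neg h, abs_of_neg h]; linarith
    · rw [h, Real.sign_zero, abs_zero]; linarith [abs_nonneg (v - k)]
    · rw [Real.sign_of_pos h, abs_of_pos h]; linarith
  linarith
end
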